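/- arXiv:2507.10410 — 10 statements merged into one kernel-verified Lean document; each statement's English description precedes it below -/
import Mathlib

section
/- Let (A, ‖·‖) be a commutative normed ring. The Berkovich spectrum M(A) — the set of all functions x : A → ℝ satisfying x(0) = 0, x(1) = 1, x(a) ≥ 0, x(ab) = x(a)·x(b), x(a+b) ≤ x(a) + x(b), and x(a) ≤ ‖a‖ for all a, b ∈ A — endowed with the topology of pointwise convergence (the subspace topology induced from the product topology on A → ℝ) is a compact Hausdorff topological space. -/
/-- The Berkovich spectrum of a commutative normed ring `A`: the set of all
functions `x : A → ℝ` that are multiplicative ring seminorms bounded by the norm. -/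
def BerkSpec (A : Type*) [NormedCommRing A] : Set (A → ℝ) :=
  {x | x 0 = 0 ∧ x 1 = 1 ∧ (∀ a, 0 ≤ x a) ∧ (∀ a b, x (a * b) = x a * x b) ∧
      (∀ a b, x (a + b) ≤ x a + x b) ∧ (∀ a, x a ≤ ‖a‖)}

theorem isClosed_berkSpec (A : Type*) [NormedCommRing A] : IsClosed (BerkSpec A) := by
  simp only [BerkSpec, Set.ofPred_and, Set.ofPred_forall]
  refine (isClosed_eq (by fun_prop) (by fun_prop)).inter <|
    (isClosed_eq (by fun_prop) (by fun_prop)).inter <| IsClosed.inter ?_ <|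
    IsClosed.inter ?_ <| IsClosed.inter ?_ ?_
  · exact isClosed_iInter fun a => isClosed_le (by fun_prop) (by fun_prop)
  · exact isClosed_iInter fun a => isClosed_iInter fun b =>
      isClosed_eq (by fun_prop) (by fun_prop)
  · exact isClosed_iInter fun a => isClosed_iInter fun b =>
      isClosed_le (by fun_prop) (by fun_prop)
  · exact isClosed_iInter fun a => isClosed_le (by fun_prop) (by fun_prop)

theorem isCompact_berkSpec (A : Type*) [NormedCommRing A] : IsCompact (BerkSpec A) :=
  (isCompact_univ_pi fun a : A => isCompact_Icc (a := (0 : ℝ)) (b := ‖a‖)).of_isClosed_subset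
    (isClosed_berkSpec A) fun _ hx a _ => ⟨hx.2.2.1 a, hx.2.2.2.2.2 a⟩

/-- The Berkovich spectrum, with the topology of pointwise convergence (the subspace
topology from the product topology on `A → ℝ`), is compact and Hausdorff. -/
theorem berkSpec_compactSpace_t2Space (A : Type*) [NormedCommRing A] :
    CompactSpace (BerkSpec A) ∧ T2Space (BerkSpec A) :=
  ⟨isCompact_iff_compactSpace.mp (isCompact_berkSpec A), inferInstance⟩
end

section
/- Every element x of M(ℤ) is of exactly one of the following four types: (i) the trivial seminorm, i.e., x(n) = 1 for all n ≠ 0; (ii) x(n) = |n|^ε for all n ≠ 0, for a unique ε ∈ (0,1]; (iii) x(n) = p^{-ε·v_p(n)} for all n ≠ 0, for a unique prime p and a unique ε ∈ (0,∞), where v_p denotes the p-adic valuation; (iv) x(n) = 0 if p ∣ n and x(n) = 1 if p ∤ n, for a unique prime p. -/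
/-- A multiplicative ring seminorm on `ℤ` bounded by the usual absolute value. -/
def IsBerkSeminorm (x : ℤ → ℝ) : Prop :=
  x 0 = 0 ∧ x 1 = 1 ∧ (∀ n, 0 ≤ x n) ∧ (∀ m n, x (m * n) = x m * x n) ∧
    (∀ m n, x (m + n) ≤ x m + x n) ∧ (∀ n : ℤ, x n ≤ |(n : ℝ)|)

/-- The Berkovich spectrum `M(ℤ)`, with the topology of pointwise convergence
(the subspace topology from the product topology on `ℤ → ℝ`). -/
abbrev BerkZ : Type := {x : ℤ → ℝ // IsBerkSeminorm x}


/-- Type (i): the trivial seminorm. -/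
def IsTrivialType (x : BerkZ) : Prop := ∀ n : ℤ, n ≠ 0 → x.1 n = 1

/-- Type (ii): `x(n) = |n|^ε` for a unique `ε ∈ (0,1]`. -/
def IsArchType (x : BerkZ) : Prop :=
  ∃! ε : ℝ, ε ∈ Set.Ioc (0:ℝ) 1 ∧ ∀ n : ℤ, n ≠ 0 → x.1 n = |(n : ℝ)| ^ ε

/-- Type (iii): `x(n) = p^(-ε·v_p(n))` for a unique prime `p` and unique `ε ∈ (0,∞)`. -/
def IsPadicType (x : BerkZ) : Prop :=
  ∃! pε : ℕ × ℝ, pε.1.Prime ∧ 0 < pε.2 ∧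
    ∀ n : ℤ, n ≠ 0 → x.1 n = (pε.1 : ℝ) ^ (-(pε.2 * (padicValInt pε.1 n : ℝ)))

/-- Type (iv): `x(n) = 0` if `p ∣ n` and `x(n) = 1` if `p ∤ n`, for a unique prime `p`. -/
def IsResidueType (x : BerkZ) : Prop :=
  ∃! p : ℕ, p.Prime ∧ ∀ n : ℤ, ((p : ℤ) ∣ n → x.1 n = 0) ∧ (¬ (p : ℤ) ∣ n → x.1 n = 1)

open Real

namespace AbsoluteValue

lemma num_div_den_eq (v : AbsoluteValue ℤ ℝ) {q : ℚ} {a b : ℤ} (hb : b ≠ 0)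
    (h : q = a / b) : v q.num / v q.den = v a / v b := by
  have hd : (q.den : ℤ) ≠ 0 := mod_cast q.den_ne_zero
  have key : q.num * b = a * q.den := by
    have hb' : (b : ℚ) ≠ 0 := mod_cast hb
    have hq : (q.num : ℚ) = q * q.den := (Rat.mul_den_eq_num q).symm
    have : (q.num : ℚ) * b = a * q.den := by
      rw [hq]
      nth_rewrite 1 [h]
      field_simp
    exact_mod_cast this
  rw [div_eq_div_iff (v.ne_zero hd) (v.ne_zero hb), ← v.map_mul, ← v.map_mul, key]

/-- The extension of a real absolute value on `ℤ` to the rational numbers. -/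
noncomputable def extendToRat (v : AbsoluteValue ℤ ℝ) : AbsoluteValue ℚ ℝ where
  toFun q := v q.num / v q.den
  map_mul' q r := by
    have hq : (q.den : ℤ) ≠ 0 := mod_cast q.den_ne_zero
    have hr : (r.den : ℤ) ≠ 0 := mod_cast r.den_ne_zero
    rw [v.num_div_den_eq (a := q.num * r.num) (b := q.den * r.den) (mul_ne_zero hq hr),
      v.map_mul, v.map_mul, mul_div_mul_comm]
    push_cast
    rw [mul_div_mul_comm, Rat.num_div_den, Rat.num_div_den]
  nonneg' q := div_nonneg (v.nonneg _) (v.nonneg _)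
  eq_zero' q := by simp
  add_le' q r := by
    have hq : (q.den : ℤ) ≠ 0 := mod_cast q.den_ne_zero
    have hr : (r.den : ℤ) ≠ 0 := mod_cast r.den_ne_zero
    have hvq := v.pos hq
    have hvr := v.pos hr
    rw [v.num_div_den_eq (a := q.num * r.den + r.num * q.den) (b := q.den * r.den)
      (mul_ne_zero hq hr), div_add_div _ _ hvq.ne' hvr.ne', v.map_mul (q.den : ℤ)]
    · gcongr
      refine (v.add_le _ _).trans_eq ?_
      simp only [v.map_mul]
      ring
    · have hq' : (q.den : ℚ) ≠ 0 := mod_cast hq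
      have hr' : (r.den : ℚ) ≠ 0 := mod_cast hr
      push_cast
      rw [← Rat.mul_den_eq_num q, ← Rat.mul_den_eq_num r]
      field_simp

@[simp]
lemma extendToRat_intCast (v : AbsoluteValue ℤ ℝ) (n : ℤ) : v.extendToRat n = v n := by
  change v (n : ℚ).num / v ((n : ℚ).den : ℤ) = v n
  simp

end AbsoluteValue

namespace BerkZ

variable (x : BerkZ)

lemma map_zero : x.1 0 = 0 := x.2.1

lemma map_one : x.1 1 = 1 := x.2.2.1

lemma nonneg (n : ℤ) : 0 ≤ x.1 n := x.2.2.2.1 n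

lemma map_mul (m n : ℤ) : x.1 (m * n) = x.1 m * x.1 n := x.2.2.2.2.1 m n

lemma add_le (m n : ℤ) : x.1 (m + n) ≤ x.1 m + x.1 n := x.2.2.2.2.2.1 m n

lemma le_abs (n : ℤ) : x.1 n ≤ |(n : ℝ)| := x.2.2.2.2.2.2 n

/-- The multiplicative map underlying a point of `M(ℤ)`. -/
def toMonoidWithZeroHom : ℤ →*₀ ℝ where
  toFun := x.1
  map_zero' := x.map_zero
  map_one' := x.map_one
  map_mul' := x.map_mul

lemma map_pow (n : ℤ) (k : ℕ) : x.1 (n ^ k) = x.1 n ^ k :=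
  _root_.map_pow x.toMonoidWithZeroHom n k

/-- A point of `M(ℤ)` with trivial kernel, as an absolute value. -/
def toAbsoluteValue (h : ∀ n : ℤ, n ≠ 0 → x.1 n ≠ 0) : AbsoluteValue ℤ ℝ where
  toFun := x.1
  map_mul' := x.map_mul
  nonneg' := x.nonneg
  eq_zero' n := ⟨fun hn ↦ by_contra fun h0 ↦ h n h0 hn, fun hn ↦ hn ▸ x.map_zero⟩
  add_le' := x.add_le

variable {x}

lemma exists_prime_map_eq_zero {n : ℤ} (hn : n ≠ 0) (hxn : x.1 n = 0) :
    ∃ p : ℕ, p.Prime ∧ x.1 p = 0 := by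
  have hnat : ∀ m : ℕ, m ≠ 0 → x.1 m = 0 → ∃ p : ℕ, p.Prime ∧ x.1 p = 0 := by
    intro m
    induction m using induction_on_primes with
    | zero => exact fun h ↦ absurd rfl h
    | one => exact fun _ h ↦ by simp [x.map_one] at h
    | prime_mul p a hp ih =>
      intro hpa h
      rw [Nat.cast_mul, x.map_mul, mul_eq_zero] at h
      exact h.elim (fun h ↦ ⟨p, hp, h⟩) (ih (right_ne_zero_of_mul hpa))
  refine hnat n.natAbs (Int.natAbs_ne_zero.mpr hn) ?_
  obtain ⟨c, hc⟩ := Int.dvd_natAbs_self (a := n)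
  rw [hc, x.map_mul, hxn, zero_mul]

lemma isResidueType_of_map_prime_eq_zero {p : ℕ} (hp : p.Prime) (hxp : x.1 p = 0) :
    IsResidueType x := by
  have hdvd (n : ℤ) (h : (p : ℤ) ∣ n) : x.1 n = 0 := by
    obtain ⟨c, rfl⟩ := h
    rw [x.map_mul, hxp, zero_mul]
  have hndvd (n : ℤ) (h : ¬ (p : ℤ) ∣ n) : x.1 n = 1 := by
    have hcop : IsCoprime n (p : ℤ) :=
      ((Nat.prime_iff_prime_int.mp hp).coprime_iff_not_dvd.mpr h).symm
    have hmod : (p : ℤ) ∣ n ^ (p - 1) - 1 := (Int.ModEq.pow_card_sub_one_eq_one hp hcop).symm.dvd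
    have hle := x.add_le (n ^ (p - 1) - 1) 1
    have hge := x.add_le (1 - n ^ (p - 1)) (n ^ (p - 1))
    rw [sub_add_cancel, hdvd _ hmod, x.map_one, x.map_pow, zero_add] at hle
    rw [sub_add_cancel, hdvd _ ((dvd_sub_comm).mp hmod), x.map_one, x.map_pow, zero_add] at hge
    exact (pow_eq_one_iff_of_nonneg (x.nonneg n) (Nat.sub_pos_of_lt hp.one_lt).ne').mp
      (hle.antisymm hge)
  refine ⟨p, ⟨hp, fun n ↦ ⟨hdvd n, hndvd n⟩⟩, fun q ⟨hq, hxq⟩ ↦ ?_⟩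
  by_contra hne
  have : ¬ (q : ℤ) ∣ p := by
    rw [Int.natCast_dvd_natCast, Nat.prime_dvd_prime_iff_eq hq hp]
    exact hne
  exact one_ne_zero (((hxq p).2 this).symm.trans hxp)

lemma isArchType_of_eq_rpow {ε : ℝ} (hε : 0 < ε)
    (h : ∀ n : ℤ, n ≠ 0 → x.1 n = |(n : ℝ)| ^ ε) : IsArchType x := by
  have h2 {δ : ℝ} (hδ : ∀ n : ℤ, n ≠ 0 → x.1 n = |(n : ℝ)| ^ δ) : x.1 2 = 2 ^ δ := by
    simpa using hδ 2 two_ne_zero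
  refine ⟨ε, ⟨⟨hε, ?_⟩, h⟩, fun δ ⟨_, hδ⟩ ↦ ?_⟩
  · have hle := x.le_abs 2
    rw [h2 h] at hle
    refine (rpow_le_rpow_left_iff one_lt_two).mp (hle.trans_eq ?_)
    simp
  · exact (rpow_right_inj two_pos (by norm_num)).mp ((h2 hδ).symm.trans (h2 h))

lemma isPadicType_of_eq_rpow {p : ℕ} (hp : p.Prime) {ε : ℝ} (hε : 0 < ε)
    (h : ∀ n : ℤ, n ≠ 0 → x.1 n = (p : ℝ) ^ (-(ε * (padicValInt p n : ℝ)))) :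
    IsPadicType x := by
  have hp1 : (1 : ℝ) < p := mod_cast hp.one_lt
  have hp0 : (p : ℤ) ≠ 0 := mod_cast hp.ne_zero
  have hxp {δ : ℝ} (hδ : ∀ n : ℤ, n ≠ 0 → x.1 n = (p : ℝ) ^ (-(δ * (padicValInt p n : ℝ)))) :
      x.1 p = (p : ℝ) ^ (-δ) := by
    rw [hδ p hp0, padicValInt.self hp.one_lt, Nat.cast_one, mul_one]
  refine ⟨(p, ε), ⟨hp, hε, h⟩, fun ⟨q, δ⟩ ⟨hq, _, hxq⟩ ↦ ?_⟩
  dsimp only at hq hxq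
  obtain rfl : q = p := by
    by_contra hne
    have hndvd : ¬ (q : ℤ) ∣ p := by
      rw [Int.natCast_dvd_natCast, Nat.prime_dvd_prime_iff_eq hq hp]
      exact hne
    have hx1 := hxq p hp0
    rw [padicValInt.eq_zero_of_not_dvd hndvd, Nat.cast_zero, mul_zero, neg_zero, rpow_zero,
      hxp h] at hx1
    exact (rpow_lt_one_of_one_lt_of_neg hp1 (neg_lt_zero.mpr hε)).ne hx1
  have := (rpow_right_inj (by positivity) hp1.ne').mp ((hxp hxq).symm.trans (hxp h))
  rw [neg_inj.mp this]

lemma eq_rpow_inv_of_isEquiv (h : ∀ n : ℤ, n ≠ 0 → x.1 n ≠ 0) {w : AbsoluteValue ℚ ℝ}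
    (hw : (x.toAbsoluteValue h).extendToRat.IsEquiv w) :
    ∃ ε : ℝ, 0 < ε ∧ ∀ n : ℤ, x.1 n = w n ^ ε := by
  obtain ⟨c, hc, hcw⟩ := AbsoluteValue.isEquiv_iff_exists_rpow_eq.mp hw
  refine ⟨c⁻¹, inv_pos.mpr hc, fun n ↦ ?_⟩
  have hn : x.1 n ^ c = w n := by
    simpa [toAbsoluteValue] using congrFun hcw n
  rw [← hn, rpow_rpow_inv (x.nonneg n) hc.ne']

lemma trivial_or_arch_or_padic_of_ne_zero (h : ∀ n : ℤ, n ≠ 0 → x.1 n ≠ 0) :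
    IsTrivialType x ∨ IsArchType x ∨ IsPadicType x := by
  by_cases hnt : (x.toAbsoluteValue h).extendToRat.IsNontrivial
  · right
    rcases Rat.AbsoluteValue.equiv_real_or_padic _ hnt with hw | ⟨p, ⟨hp, hw⟩, -⟩
    · obtain ⟨ε, hε, hx⟩ := eq_rpow_inv_of_isEquiv h hw
      exact .inl <| isArchType_of_eq_rpow hε fun n _ ↦ by simpa using hx n
    · obtain ⟨ε, hε, hx⟩ := eq_rpow_inv_of_isEquiv h hw
      refine .inr <| isPadicType_of_eq_rpow hp.out hε fun n hn ↦ ?_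
      rw [hx n, Rat.AbsoluteValue.padic_eq_padicNorm,
        padicNorm.eq_zpow_of_nonzero (mod_cast hn), padicValRat.of_int]
      push_cast
      rw [← rpow_intCast, ← rpow_mul (by positivity)]
      congr 1
      push_cast
      ring
  · left
    intro n hn
    simpa [toAbsoluteValue] using
      AbsoluteValue.not_isNontrivial_apply hnt (x := (n : ℚ)) (mod_cast hn)

lemma classification_exists (x : BerkZ) :
    IsTrivialType x ∨ IsArchType x ∨ IsPadicType x ∨ IsResidueType x := by
  by_cases h : ∀ n : ℤ, n ≠ 0 → x.1 n ≠ 0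
  · rcases trivial_or_arch_or_padic_of_ne_zero h with h | h | h <;> simp [h]
  · push Not at h
    obtain ⟨n, hn, hxn⟩ := h
    obtain ⟨p, hp, hxp⟩ := exists_prime_map_eq_zero hn hxn
    exact .inr <| .inr <| .inr <| isResidueType_of_map_prime_eq_zero hp hxp

end BerkZ

variable {x : BerkZ}

lemma IsArchType.one_lt_map_two (h : IsArchType x) : 1 < x.1 2 := by
  obtain ⟨ε, ⟨⟨hε, _⟩, hx⟩, -⟩ := h
  have h2 : x.1 2 = 2 ^ ε := by simpa using hx 2 two_ne_zero
  exact h2 ▸ one_lt_rpow one_lt_two hε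

lemma IsPadicType.map_pos (h : IsPadicType x) {n : ℤ} (hn : n ≠ 0) : 0 < x.1 n := by
  obtain ⟨⟨p, ε⟩, ⟨hp, hε, hx⟩, -⟩ := h
  have : (0 : ℝ) < p := mod_cast hp.pos
  exact hx n hn ▸ rpow_pos_of_pos this _

lemma IsPadicType.map_le_one (h : IsPadicType x) {n : ℤ} (hn : n ≠ 0) : x.1 n ≤ 1 := by
  obtain ⟨⟨p, ε⟩, ⟨hp, hε, hx⟩, -⟩ := h
  have : (1 : ℝ) ≤ p := mod_cast hp.one_le
  refine hx n hn ▸ rpow_le_one_of_one_le_of_nonpos this (neg_nonpos.mpr ?_)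
  exact mul_nonneg hε.le (Nat.cast_nonneg _)

lemma IsPadicType.exists_map_lt_one (h : IsPadicType x) : ∃ n ≠ 0, x.1 n < 1 := by
  obtain ⟨⟨p, ε⟩, ⟨hp, hε, hx⟩, -⟩ := h
  dsimp only at hp hε hx
  have hp0 : (p : ℤ) ≠ 0 := mod_cast hp.ne_zero
  refine ⟨p, hp0, ?_⟩
  rw [hx p hp0, padicValInt.self hp.one_lt, Nat.cast_one, mul_one]
  exact rpow_lt_one_of_one_lt_of_neg (mod_cast hp.one_lt) (neg_lt_zero.mpr hε)

lemma IsResidueType.map_le_one (h : IsResidueType x) (n : ℤ) : x.1 n ≤ 1 := by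
  obtain ⟨p, ⟨_, hx⟩, -⟩ := h
  by_cases hn : (p : ℤ) ∣ n
  · exact (hx n).1 hn ▸ zero_le_one
  · exact ((hx n).2 hn).le

lemma IsResidueType.exists_map_eq_zero (h : IsResidueType x) : ∃ n ≠ 0, x.1 n = 0 := by
  obtain ⟨p, ⟨hp, hx⟩, -⟩ := h
  exact ⟨p, mod_cast hp.ne_zero, (hx p).1 dvd_rfl⟩

/-- Every point of `M(ℤ)` is of exactly one of the four types. -/
theorem berkZ_classification (x : BerkZ) :
    (IsTrivialType x ∨ IsArchType x ∨ IsPadicType x ∨ IsResidueType x) ∧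
      ¬(IsTrivialType x ∧ IsArchType x) ∧ ¬(IsTrivialType x ∧ IsPadicType x) ∧
      ¬(IsTrivialType x ∧ IsResidueType x) ∧ ¬(IsArchType x ∧ IsPadicType x) ∧
      ¬(IsArchType x ∧ IsResidueType x) ∧ ¬(IsPadicType x ∧ IsResidueType x) := by
  refine ⟨x.classification_exists, ?_, ?_, ?_, ?_, ?_, ?_⟩
  · rintro ⟨h, h'⟩
    exact h'.one_lt_map_two.ne' (h 2 two_ne_zero)
  · rintro ⟨h, h'⟩
    obtain ⟨n, hn, hlt⟩ := h'.exists_map_lt_one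
    exact hlt.ne (h n hn)
  · rintro ⟨h, h'⟩
    obtain ⟨n, hn, h0⟩ := h'.exists_map_eq_zero
    exact one_ne_zero ((h n hn).symm.trans h0)
  · rintro ⟨h, h'⟩
    exact (h'.map_le_one two_ne_zero).not_gt h.one_lt_map_two
  · rintro ⟨h, h'⟩
    exact (h'.map_le_one 2).not_gt h.one_lt_map_two
  · rintro ⟨h, h'⟩
    obtain ⟨n, hn, h0⟩ := h'.exists_map_eq_zero
    exact (h.map_pos hn).ne' h0
end

section
/- For every prime p, there is exactly one element x of M(ℤ) with x(p) = 0, namely the seminorm given by x(n) = 0 if p ∣ n and x(n) = 1 if p ∤ n. -/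
/-- A member of `M(ℤ)` vanishing at an integer vanishes at all of its multiples. -/
theorem IsBerkSeminorm.eq_zero_of_dvd {x : ℤ → ℝ} (hx : IsBerkSeminorm x) {a n : ℤ}
    (ha : x a = 0) (h : a ∣ n) : x n = 0 := by
  obtain ⟨-, -, -, hmul, -, -⟩ := hx
  obtain ⟨k, rfl⟩ := h
  rw [hmul, ha, zero_mul]

theorem IsBerkSeminorm.map_pow {x : ℤ → ℝ} (hx : IsBerkSeminorm x) (n : ℤ) (k : ℕ) :
    x (n ^ k) = x n ^ k := by
  obtain ⟨-, h1, -, hmul, -, -⟩ := hx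
  induction k with
  | zero => simpa using h1
  | succ k ih => rw [pow_succ, hmul, ih, pow_succ]

/-- A member of `M(ℤ)` vanishing at `a` takes equal values on integers congruent modulo `a`. -/
theorem IsBerkSeminorm.eq_of_dvd_sub {x : ℤ → ℝ} (hx : IsBerkSeminorm x) {a m n : ℤ}
    (ha : x a = 0) (h : a ∣ m - n) : x m = x n := by
  have key : ∀ m n : ℤ, a ∣ m - n → x m ≤ x n := fun m n h => by
    have hadd := hx.2.2.2.2.1 (m - n) n
    rwa [sub_add_cancel, hx.eq_zero_of_dvd ha h, zero_add] at hadd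
  exact le_antisymm (key m n h) (key n m (by rwa [dvd_sub_comm]))

theorem IsBerkSeminorm.eq_one_of_not_dvd {x : ℤ → ℝ} (hx : IsBerkSeminorm x) {p : ℕ}
    (hp : p.Prime) (h0 : x p = 0) {n : ℤ} (hn : ¬ (p : ℤ) ∣ n) : x n = 1 := by
  have hcop : IsCoprime n (p : ℤ) :=
    ((Nat.prime_iff_prime_int.mp hp).coprime_iff_not_dvd.mpr hn).symm
  have hfermat : n ^ (p - 1) ≡ 1 [ZMOD p] := Int.ModEq.pow_card_sub_one_eq_one hp hcop
  have hpow : x n ^ (p - 1) = 1 := by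
    rw [← hx.map_pow, hx.eq_of_dvd_sub h0 hfermat.symm.dvd, hx.2.1]
  exact (pow_eq_one_iff_of_nonneg (hx.2.2.1 n) (Nat.sub_pos_of_lt hp.one_lt).ne').mp hpow

/-- The trivial seminorm on `ℤ ⧸ p`, pulled back to `ℤ`, belongs to `M(ℤ)`. -/
theorem isBerkSeminorm_residue {p : ℕ} (hp : p.Prime) :
    IsBerkSeminorm fun n => if (p : ℤ) ∣ n then 0 else 1 := by
  have hpr : Prime (p : ℤ) := Nat.prime_iff_prime_int.mp hp
  refine ⟨by simp, if_neg hpr.not_dvd_one, fun n => ?_, fun m n => ?_, fun m n => ?_,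
    fun n => ?_⟩
  · dsimp only
    split_ifs <;> norm_num
  · by_cases hm : (p : ℤ) ∣ m <;> by_cases hn : (p : ℤ) ∣ n <;> simp [hpr.dvd_mul, hm, hn]
  · by_cases hm : (p : ℤ) ∣ m
    · simp [hm, dvd_add_right hm]
    · dsimp only
      rw [if_neg hm]
      split_ifs <;> norm_num
  · dsimp only
    split_ifs with h
    · positivity
    · have hn : n ≠ 0 := fun h0 => h (h0 ▸ dvd_zero _)
      exact_mod_cast Int.one_le_abs hn

/-- For every prime `p` there is exactly one `x ∈ M(ℤ)` with `x(p) = 0`, namely the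
seminorm with `x(n) = 0` for `p ∣ n` and `x(n) = 1` for `p ∤ n`. -/
theorem berkZ_unique_vanishing_at_prime (p : ℕ) (hp : p.Prime) :
    (∃! x : BerkZ, x.1 (p : ℤ) = 0) ∧
      ∀ x : BerkZ, x.1 (p : ℤ) = 0 →
        ∀ n : ℤ, ((p : ℤ) ∣ n → x.1 n = 0) ∧ (¬ (p : ℤ) ∣ n → x.1 n = 1) := by
  refine ⟨⟨⟨_, isBerkSeminorm_residue hp⟩, if_pos dvd_rfl, fun y hy => ?_⟩, fun x hx n =>
    ⟨x.2.eq_zero_of_dvd hx, x.2.eq_one_of_not_dvd hp hx⟩⟩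
  ext n
  dsimp only
  split_ifs with h
  · exact y.2.eq_zero_of_dvd hy h
  · exact y.2.eq_one_of_not_dvd hp hy h
end

section
/- For every prime p, the map f_p : [0,1] → M(ℤ) defined by f_p(ε)(n) = ε^{v_p(n)} for n ≠ 0 (with the convention 0^0 = 1) and f_p(ε)(0) = 0 is well defined (i.e., each f_p(ε) is a multiplicative ring seminorm on ℤ bounded by the usual absolute value) and is a topological embedding, i.e., a homeomorphism of [0,1] onto its image in M(ℤ). -/
/-- The branch map at a finite prime: `f_p(ε)(n) = ε ^ v_p(n)` for `n ≠ 0`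
(with the convention `0 ^ 0 = 1`), and `f_p(ε)(0) = 0`. -/
def fp (p : ℕ) (ε : ℝ) : ℤ → ℝ := fun n => if n = 0 then 0 else ε ^ padicValInt p n

/-- The ultrametric inequality for `padicValInt`. -/
theorem min_padicValInt_le_padicValInt_add {p : ℕ} [Fact p.Prime] {m n : ℤ} (h : m + n ≠ 0) :
    min (padicValInt p m) (padicValInt p n) ≤ padicValInt p (m + n) := by
  have hdvd : (p : ℤ) ^ min (padicValInt p m) (padicValInt p n) ∣ m + n :=
    dvd_add ((padicValInt_dvd_iff _ m).2 (Or.inr (min_le_left _ _)))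
      ((padicValInt_dvd_iff _ n).2 (Or.inr (min_le_right _ _)))
  exact ((padicValInt_dvd_iff _ _).1 hdvd).resolve_left h

theorem fp_nonneg (p : ℕ) {ε : ℝ} (hε : 0 ≤ ε) (n : ℤ) : 0 ≤ fp p ε n := by
  unfold fp
  split_ifs
  · exact le_rfl
  · exact pow_nonneg hε _

theorem fp_mul {p : ℕ} [Fact p.Prime] (ε : ℝ) (m n : ℤ) :
    fp p ε (m * n) = fp p ε m * fp p ε n := by
  by_cases hm : m = 0
  · simp [fp, hm]
  by_cases hn : n = 0
  · simp [fp, hn]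
  simp [fp, hm, hn, padicValInt.mul, pow_add]

theorem fp_add_le {p : ℕ} [Fact p.Prime] {ε : ℝ} (hε₀ : 0 ≤ ε) (hε₁ : ε ≤ 1) (m n : ℤ) :
    fp p ε (m + n) ≤ fp p ε m + fp p ε n := by
  by_cases hm : m = 0
  · simp [fp, hm]
  by_cases hn : n = 0
  · simp [fp, hn]
  by_cases hmn : m + n = 0
  · simpa [fp, hmn] using add_nonneg (fp_nonneg p hε₀ m) (fp_nonneg p hε₀ n)
  simp only [fp, hm, hn, hmn, if_false]
  refine (pow_le_pow_of_le_one hε₀ hε₁ (min_padicValInt_le_padicValInt_add hmn)).trans ?_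
  rcases min_choice (padicValInt p m) (padicValInt p n) with h | h <;> rw [h]
  · exact le_add_of_nonneg_right (pow_nonneg hε₀ _)
  · exact le_add_of_nonneg_left (pow_nonneg hε₀ _)

theorem fp_le_abs (p : ℕ) {ε : ℝ} (hε₀ : 0 ≤ ε) (hε₁ : ε ≤ 1) (n : ℤ) :
    fp p ε n ≤ |(n : ℝ)| := by
  by_cases hn : n = 0
  · simp [fp, hn]
  simp only [fp, hn, if_false]
  exact (pow_le_one₀ hε₀ hε₁).trans (by exact_mod_cast Int.one_le_abs hn)

theorem isBerkSeminorm_fp {p : ℕ} [Fact p.Prime] {ε : ℝ} (hε₀ : 0 ≤ ε) (hε₁ : ε ≤ 1) :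
    IsBerkSeminorm (fp p ε) :=
  ⟨by simp [fp], by simp [fp], fp_nonneg p hε₀, fp_mul ε, fp_add_le hε₀ hε₁,
    fp_le_abs p hε₀ hε₁⟩

theorem continuous_fp (p : ℕ) : Continuous (fp p) := by
  refine continuous_pi fun n => ?_
  unfold fp
  split_ifs <;> fun_prop

theorem fp_self {p : ℕ} [hp : Fact p.Prime] (ε : ℝ) : fp p ε p = ε := by
  simp [fp, hp.out.ne_zero, padicValInt.self hp.out.one_lt]

/-- For every prime `p`, the map `f_p : [0,1] → M(ℤ)` is well defined and is a
topological embedding. -/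
theorem fp_isBerkSeminorm_isEmbedding (p : ℕ) (hp : p.Prime) :
    ∃ h : ∀ ε : Set.Icc (0:ℝ) 1, IsBerkSeminorm (fp p ε.1),
      Topology.IsEmbedding (fun ε : Set.Icc (0:ℝ) 1 => (⟨fp p ε.1, h ε⟩ : BerkZ)) := by
  have : Fact p.Prime := ⟨hp⟩
  refine ⟨fun ε => isBerkSeminorm_fp ε.2.1 ε.2.2, ?_⟩
  refine Topology.IsEmbedding.of_comp (g := fun x : BerkZ => x.1 p)
    (((continuous_fp p).comp continuous_subtype_val).subtype_mk _)
    ((continuous_apply (p : ℤ)).comp continuous_subtype_val) ?_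
  convert Topology.IsEmbedding.subtypeVal (p := (· ∈ Set.Icc (0:ℝ) 1)) using 1
  exact funext fun ε => fp_self ε.1
end

section
/- The map f_∞ : [0,1] → M(ℤ) defined by f_∞(ε)(n) = |n|^ε for n ≠ 0 and f_∞(ε)(0) = 0 is well defined (i.e., each f_∞(ε) is a multiplicative ring seminorm on ℤ bounded by the usual absolute value) and is a topological embedding, i.e., a homeomorphism of [0,1] onto its image in M(ℤ). -/
/-- The Archimedean branch map: `f_∞(ε)(n) = |n| ^ ε` for `n ≠ 0` and `f_∞(ε)(0) = 0`. -/
noncomputable def finfty (ε : ℝ) : ℤ → ℝ := fun n => if n = 0 then 0 else |(n : ℝ)| ^ ε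

theorem abs_rpow_le_abs {ε : ℝ} (hε : ε ≤ 1) (n : ℤ) (hn : n ≠ 0) :
    |(n : ℝ)| ^ ε ≤ |(n : ℝ)| := by
  have h : (1 : ℝ) ≤ |(n : ℝ)| := mod_cast Int.one_le_abs hn
  simpa using Real.rpow_le_rpow_of_exponent_le h hε

theorem finfty_add_le {ε : ℝ} (h₀ : 0 ≤ ε) (h₁ : ε ≤ 1) (m n : ℤ) :
    finfty ε (m + n) ≤ finfty ε m + finfty ε n := by
  by_cases hm : m = 0
  · simp [finfty, hm]
  by_cases hn : n = 0
  · simp [finfty, hn]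
  by_cases hmn : m + n = 0
  · simp only [finfty, hm, hn, hmn, if_true, if_false]
    positivity
  · simp only [finfty, hm, hn, hmn, if_false, Int.cast_add]
    exact (Real.rpow_le_rpow (abs_nonneg _) (abs_add_le _ _) h₀).trans
      (Real.rpow_add_le_add_rpow (abs_nonneg _) (abs_nonneg _) h₀ h₁)

theorem isBerkSeminorm_finfty {ε : ℝ} (h₀ : 0 ≤ ε) (h₁ : ε ≤ 1) : IsBerkSeminorm (finfty ε) := by
  refine ⟨by simp [finfty], by simp [finfty], fun n => ?_, fun m n => ?_, finfty_add_le h₀ h₁,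
    fun n => ?_⟩
  · unfold finfty
    split_ifs <;> positivity
  · by_cases hm : m = 0
    · simp [finfty, hm]
    by_cases hn : n = 0
    · simp [finfty, hn]
    simp [finfty, hm, hn, abs_mul, Real.mul_rpow]
  · by_cases hn : n = 0
    · simp [finfty, hn]
    · simpa only [finfty, hn, if_false] using abs_rpow_le_abs h₁ n hn

theorem continuous_finfty : Continuous finfty := by
  refine continuous_pi fun n => ?_
  by_cases hn : n = 0
  · simpa only [finfty, hn, if_true] using continuous_const
  · simp only [finfty, hn, if_false]
    exact continuous_const.rpow continuous_id fun _ => Or.inl (by simpa using hn)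

theorem finfty_injective : Function.Injective finfty := by
  intro a b hab
  have h : (2 : ℝ) ^ a = 2 ^ b := by simpa [finfty] using congrFun hab 2
  exact (Real.strictMono_rpow_of_base_gt_one one_lt_two).injective h

/-- The map `f_∞ : [0,1] → M(ℤ)` is well defined and is a topological embedding. -/
theorem finfty_isBerkSeminorm_isEmbedding :
    ∃ h : ∀ ε : Set.Icc (0:ℝ) 1, IsBerkSeminorm (finfty ε.1),
      Topology.IsEmbedding (fun ε : Set.Icc (0:ℝ) 1 => (⟨finfty ε.1, h ε⟩ : BerkZ)) := by
  refine ⟨fun ε => isBerkSeminorm_finfty ε.2.1 ε.2.2, ?_⟩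
  refine (Continuous.isClosedEmbedding ?_ ?_).isEmbedding
  · exact (continuous_finfty.comp continuous_subtype_val).subtype_mk _
  · exact fun a b hab => Subtype.ext (finfty_injective (congrArg Subtype.val hab))
end

section
/- The topology of pointwise convergence on M(ℤ) coincides with the topology generated by the sets U⁺_{p,t} = {x ∈ M(ℤ) : x(p) > t} and U⁻_{p,t} = {x ∈ M(ℤ) : x(p) < t}, where p ranges over the prime numbers and t ranges over the real numbers. -/
theorem IsBerkSeminorm.apply_neg {x : ℤ → ℝ} (hx : IsBerkSeminorm x) (n : ℤ) :
    x (-n) = x n := by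
  obtain ⟨-, h1, hnonneg, hmul, -, -⟩ := hx
  have hsq : x (-1) * x (-1) = 1 := by rw [← hmul]; simpa using h1
  have hneg : x (-1) = 1 := by nlinarith [hnonneg (-1)]
  rw [← neg_one_mul, hmul, hneg, one_mul]

/-- If evaluation at every prime is continuous on a family of Berkovich seminorms,
then evaluation at every integer is. -/
theorem continuous_eval_of_continuous_eval_prime {X : Type*} [TopologicalSpace X]
    (f : X → BerkZ) (hf : ∀ p : ℕ, p.Prime → Continuous fun a => (f a).1 (p : ℤ)) (n : ℤ) :
    Continuous fun a => (f a).1 n := by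
  have hnat : ∀ m : ℕ, Continuous fun a => (f a).1 (m : ℤ) := by
    intro m
    induction m using Nat.recOnMul with
    | zero => simpa [(f _).2.1] using continuous_const
    | one => simpa [(f _).2.2.1] using continuous_const
    | prime p hp => exact hf p hp
    | mul a b ha hb => simpa [(f _).2.2.2.2.1, Pi.mul_def] using ha.mul hb
  obtain ⟨m, rfl | rfl⟩ := n.eq_nat_or_neg
  · exact hnat m
  · simpa only [(f _).2.apply_neg] using hnat m

/-- The topology of pointwise convergence on `M(ℤ)` is generated by the subbasic sets
`U⁺_{p,t} = {x : x(p) > t}` and `U⁻_{p,t} = {x : x(p) < t}` for `p` prime and `t` real. -/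
theorem berkZ_topology_generated_by_prime_evaluations :
    (inferInstance : TopologicalSpace BerkZ) =
      TopologicalSpace.generateFrom
        {S : Set BerkZ | ∃ (p : ℕ) (t : ℝ), p.Prime ∧
          (S = {x : BerkZ | t < x.1 (p : ℤ)} ∨ S = {x : BerkZ | x.1 (p : ℤ) < t})} := by
  apply le_antisymm
  · refine le_generateFrom ?_
    rintro _ ⟨p, t, -, rfl | rfl⟩
    · exact isOpen_lt continuous_const ((continuous_apply (p : ℤ)).comp continuous_subtype_val)
    · exact isOpen_lt ((continuous_apply (p : ℤ)).comp continuous_subtype_val) continuous_const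
  · refine continuous_iff_le_induced.1 ?_
    refine @continuous_pi _ _ _ (_) _ _ fun n => ?_
    refine @continuous_eval_of_continuous_eval_prime _ (_) id (fun p hp => ?_) n
    rw [OrderTopology.topology_eq_generate_intervals (α := ℝ), continuous_generateFrom_iff]
    rintro _ ⟨t, rfl | rfl⟩
    · exact .basic _ ⟨p, t, hp, .inl rfl⟩
    · exact .basic _ ⟨p, t, hp, .inr rfl⟩
end

section
/- If x ∈ M(ℤ) satisfies x(n₀) > 1 for some integer n₀, then there exists a unique ε ∈ (0,1] such that x(n) = |n|^ε for all nonzero integers n. -/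
namespace IsBerkSeminorm

variable {x : ℤ → ℝ}

theorem map_pow_s9 (hx : IsBerkSeminorm x) (n : ℤ) (k : ℕ) : x (n ^ k) = x n ^ k := by
  obtain ⟨-, h1, -, hmul, -⟩ := hx
  induction k with
  | zero => simpa using h1
  | succ k ih => rw [pow_succ, hmul, ih, pow_succ]

theorem map_neg (hx : IsBerkSeminorm x) (n : ℤ) : x (-n) = x n := by
  obtain ⟨-, h1, hnn, hmul, -⟩ := hx
  have h : x (-1) * x (-1) = 1 := by rw [← hmul]; simpa using h1
  have h' : x (-1) = 1 := by nlinarith [hnn (-1)]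
  rw [← neg_one_mul, hmul, h', one_mul]

/-- A seminorm that takes a value larger than `1` has trivial kernel. -/
theorem pos_of_gt_one (hx : IsBerkSeminorm x) {n₀ : ℤ} (h : 1 < x n₀) {m : ℤ} (hm : m ≠ 0) :
    0 < x m := by
  refine (hx.2.2.1 m).lt_of_ne' fun hxm => ?_
  obtain ⟨k, hk⟩ := pow_unbounded_of_one_lt |(m : ℝ)| h
  have hpow := hx.map_pow_s9 n₀ k
  obtain ⟨-, -, -, hmul, hadd, hle⟩ := hx
  have h1 := hadd (n₀ ^ k % m) (m * (n₀ ^ k / m))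
  rw [Int.emod_add_mul_ediv, hmul, hxm, zero_mul, add_zero] at h1
  have h2 := hle (n₀ ^ k % m)
  have h3 : |((n₀ ^ k % m : ℤ) : ℝ)| < |(m : ℝ)| := by
    rw [abs_of_nonneg (by exact_mod_cast Int.emod_nonneg _ hm)]
    exact_mod_cast Int.emod_lt_abs _ hm
  linarith

/-- The extension to `ℚ` of a seminorm on `ℤ` with trivial kernel. -/
noncomputable def toRat (hx : IsBerkSeminorm x) (hpos : ∀ m, m ≠ 0 → 0 < x m) :
    AbsoluteValue ℚ ℝ where
  toFun q := x q.num / x q.den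
  map_mul' q r := by
    have hq := hpos q.den (by exact_mod_cast q.den_nz)
    have hr := hpos r.den (by exact_mod_cast r.den_nz)
    have hqr := hpos (q * r).den (by exact_mod_cast (q * r).den_nz)
    have key := congrArg x (Rat.mul_num_den' q r)
    simp only [hx.2.2.2.1] at key
    rw [div_mul_div_comm, div_eq_div_iff hqr.ne' (mul_pos hq hr).ne']
    linarith
  nonneg' q := div_nonneg (hx.2.2.1 _) (hx.2.2.1 _)
  eq_zero' q := by
    have hq := hpos q.den (by exact_mod_cast q.den_nz)
    rw [div_eq_zero_iff, or_iff_left hq.ne', ← Rat.num_eq_zero]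
    exact ⟨fun h => by_contra fun h' => (hpos _ h').ne' h, fun h => h ▸ hx.1⟩
  add_le' q r := by
    have hq := hpos q.den (by exact_mod_cast q.den_nz)
    have hr := hpos r.den (by exact_mod_cast r.den_nz)
    have hqr := hpos (q + r).den (by exact_mod_cast (q + r).den_nz)
    have key := congrArg x (Rat.add_num_den' q r)
    have hadd := hx.2.2.2.2.1 (q.num * r.den) (r.num * q.den)
    simp only [hx.2.2.2.1] at key hadd
    rw [div_add_div _ _ hq.ne' hr.ne', div_le_div_iff₀ hqr (mul_pos hq hr)]
    nlinarith

theorem toRat_intCast (hx : IsBerkSeminorm x) (hpos : ∀ m, m ≠ 0 → 0 < x m) (n : ℤ) :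
    hx.toRat hpos n = x n := by
  change x (n : ℚ).num / x (n : ℚ).den = x n
  simp [hx.2.1]

end IsBerkSeminorm

/-- If `x ∈ M(ℤ)` satisfies `x(n₀) > 1` for some integer `n₀`, then there is a unique
`ε ∈ (0,1]` with `x(n) = |n|^ε` for all nonzero integers `n`. -/
theorem berkZ_arch_of_gt_one (x : BerkZ) (n₀ : ℤ) (h : 1 < x.1 n₀) :
    ∃! ε : ℝ, ε ∈ Set.Ioc (0:ℝ) 1 ∧ ∀ n : ℤ, n ≠ 0 → x.1 n = |(n : ℝ)| ^ ε := by
  obtain ⟨x, hx⟩ := x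
  dsimp only at h ⊢
  have hpos : ∀ m, m ≠ 0 → 0 < x m := fun m hm => hx.pos_of_gt_one h hm
  have hnatAbs (n : ℤ) : x n.natAbs = x n := by
    rcases Int.natAbs_eq n with hn | hn
    · rw [← hn]
    · conv_rhs => rw [hn, hx.map_neg]
  have hnat (n : ℕ) : hx.toRat hpos n = x n := by
    simpa using hx.toRat_intCast hpos n
  have hunb : ¬ ∀ n : ℕ, hx.toRat hpos n ≤ 1 := fun hb => by
    have := hb n₀.natAbs
    rw [hnat, hnatAbs] at this
    linarith
  obtain ⟨c, hc, hcn⟩ := Rat.AbsoluteValue.exists_nat_rpow_iff_isEquiv.mpr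
    (Rat.AbsoluteValue.equiv_real_of_unbounded hunb)
  have hval (n : ℤ) : x n = |(n : ℝ)| ^ c⁻¹ := by
    have := hcn n.natAbs
    rw [hnat, hnatAbs, Rat.AbsoluteValue.real_eq_abs] at this
    rw [Real.eq_rpow_inv (hx.2.2.1 n) (abs_nonneg _) hc.ne', this]
    simp
  have htwo : x 2 = 2 ^ c⁻¹ := by simpa using hval 2
  have hle : c⁻¹ ≤ 1 := by
    have h2 := hx.2.2.2.2.2 2
    rw [htwo] at h2
    rw [← Real.rpow_le_rpow_left_iff (one_lt_two (α := ℝ))]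
    simpa using h2
  refine ⟨c⁻¹, ⟨⟨inv_pos.mpr hc, hle⟩, fun n _ => hval n⟩, fun ε ⟨_, hε⟩ => ?_⟩
  have h2 := hε 2 two_ne_zero
  rw [htwo] at h2
  have h3 : (2 : ℝ) ^ ε = 2 ^ c⁻¹ := by simpa using h2.symm
  exact (Real.rpow_right_inj two_pos (by norm_num)).mp h3
end

section
/- If x ∈ M(ℤ) satisfies x(n) ≤ 1 for all n ∈ ℤ, x(n) ≠ 0 for all n ≠ 0, and x is not the trivial seminorm (i.e., x(n₀) < 1 for some n₀ ≠ 0), then there exist a unique prime p and a unique ε ∈ (0,∞) such that x(n) = p^{-ε·v_p(n)} for all nonzero integers n, where v_p denotes the p-adic valuation. -/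
open Filter Topology in
/-- Two coprime integers cannot both have value less than `1`. -/
theorem IsBerkSeminorm.not_lt_one_of_isCoprime {x : ℤ → ℝ} (hx : IsBerkSeminorm x)
    (hb : ∀ n : ℤ, x n ≤ 1) {a b : ℤ} (hab : IsCoprime a b) (ha : x a < 1) : ¬ x b < 1 := by
  intro hb1
  obtain ⟨-, h1, hnn, hmul, hadd, -⟩ := hx
  have hpow (c : ℤ) (k : ℕ) : x (c ^ k) = x c ^ k := by
    induction k with
    | zero => simpa using h1
    | succ k ih => rw [pow_succ, hmul, ih, pow_succ]
  have hle (k : ℕ) : 1 ≤ x a ^ k + x b ^ k := by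
    obtain ⟨u, v, huv⟩ := hab.pow (m := k) (n := k)
    calc (1 : ℝ) = x (u * a ^ k + v * b ^ k) := by rw [huv, h1]
      _ ≤ x u * x a ^ k + x v * x b ^ k := by
        simpa only [hmul, hpow] using hadd (u * a ^ k) (v * b ^ k)
      _ ≤ x a ^ k + x b ^ k := add_le_add
        (mul_le_of_le_one_left (pow_nonneg (hnn a) k) (hb u))
        (mul_le_of_le_one_left (pow_nonneg (hnn b) k) (hb v))
  have hlim : Tendsto (fun k : ℕ => x a ^ k + x b ^ k) atTop (𝓝 (0 + 0)) :=
    (tendsto_pow_atTop_nhds_zero_of_lt_one (hnn a) ha).add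
      (tendsto_pow_atTop_nhds_zero_of_lt_one (hnn b) hb1)
  linarith [ge_of_tendsto' hlim hle]

/-- A nontrivial seminorm bounded by `1` takes a value less than `1` at some prime number. -/
theorem IsBerkSeminorm.exists_prime_lt_one {x : ℤ → ℝ} (hx : IsBerkSeminorm x)
    (hb : ∀ n : ℤ, x n ≤ 1) {n₀ : ℤ} (hn₀ : n₀ ≠ 0) (hlt : x n₀ < 1) :
    ∃ p : ℕ, p.Prime ∧ x p < 1 := by
  obtain ⟨-, h1, hnn, hmul, -, -⟩ := hx
  by_contra! hp
  have hneg : x (-1) = 1 := by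
    have h : x (-1) * x (-1) = 1 := by rw [← hmul]; simpa using h1
    nlinarith [hnn (-1)]
  have hnat (n : ℕ) : n ≠ 0 → x n = 1 := by
    induction n using induction_on_primes with
    | zero => simp
    | one => simpa using h1
    | prime_mul q a hq ih =>
      intro h
      rw [Nat.cast_mul, hmul, ih (right_ne_zero_of_mul h), mul_one]
      exact le_antisymm (hb q) (hp q hq)
  have habs := hnat n₀.natAbs (Int.natAbs_ne_zero.mpr hn₀)
  rcases Int.natAbs_eq n₀ with h | h
  · rw [← h] at habs
    exact hlt.ne habs
  · rw [h, ← neg_one_mul, hmul, hneg, habs] at hlt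
    norm_num at hlt

/-- If `x p < 1` at a prime `p`, then `x` is determined by `x p` and the `p`-adic valuation. -/
theorem IsBerkSeminorm.eq_pow_padicValInt {x : ℤ → ℝ} (hx : IsBerkSeminorm x)
    (hb : ∀ n : ℤ, x n ≤ 1) {p : ℕ} (hp : p.Prime) (hlt : x p < 1) {n : ℤ} (hn : n ≠ 0) :
    x n = x p ^ padicValInt p n := by
  have := Fact.mk hp
  have hpZ : Prime (p : ℤ) := Nat.prime_iff_prime_int.mp hp
  obtain ⟨m, hm⟩ := padicValInt_dvd (p := p) n
  have hndvd : ¬ (p : ℤ) ∣ m := by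
    rintro ⟨c, rfl⟩
    have h : (p : ℤ) ^ (padicValInt p n + 1) ∣ n := ⟨c, by rw [pow_succ, mul_assoc, ← hm]⟩
    rcases (padicValInt_dvd_iff _ n).mp h with h | h
    · exact hn h
    · omega
  have hm1 : x m = 1 := le_antisymm (hb m) <| not_lt.mp <|
    hx.not_lt_one_of_isCoprime hb ((Prime.coprime_iff_not_dvd hpZ).mpr hndvd) hlt
  obtain ⟨-, h1, -, hmul, -, -⟩ := hx
  have hpow (k : ℕ) : x ((p : ℤ) ^ k) = x p ^ k := by
    induction k with
    | zero => simpa using h1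
    | succ k ih => rw [pow_succ, hmul, ih, pow_succ]
  calc x n = x ((p : ℤ) ^ padicValInt p n * m) := by rw [← hm]
    _ = x p ^ padicValInt p n := by rw [hmul, hpow, hm1, mul_one]

/-- If `x ∈ M(ℤ)` is bounded by `1`, vanishes nowhere on nonzero integers, and is not
the trivial seminorm, then `x(n) = p^(-ε·v_p(n))` for a unique prime `p` and a unique
`ε ∈ (0,∞)`. -/
theorem berkZ_padic_of_nontrivial_bounded (x : BerkZ)
    (hb : ∀ n : ℤ, x.1 n ≤ 1) (hnz : ∀ n : ℤ, n ≠ 0 → x.1 n ≠ 0)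
    (hnt : ∃ n₀ : ℤ, n₀ ≠ 0 ∧ x.1 n₀ < 1) :
    ∃! pε : ℕ × ℝ, pε.1.Prime ∧ 0 < pε.2 ∧
      ∀ n : ℤ, n ≠ 0 → x.1 n = (pε.1 : ℝ) ^ (-(pε.2 * (padicValInt pε.1 n : ℝ))) := by
  obtain ⟨x, hx⟩ := x
  obtain ⟨n₀, hn₀, hlt₀⟩ := hnt
  dsimp only at hb hnz hlt₀ ⊢
  obtain ⟨p, hp, hlt⟩ := hx.exists_prime_lt_one hb hn₀ hlt₀
  have hp1 : (1 : ℝ) < p := by exact_mod_cast hp.one_lt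
  have hp0 : (0 : ℝ) < p := by linarith
  have hxp : 0 < x p := lt_of_le_of_ne (hx.2.2.1 p)
    (hnz p (by exact_mod_cast hp.ne_zero)).symm
  have hε : (p : ℝ) ^ (-(-Real.logb p (x p))) = x p := by
    rw [neg_neg, Real.rpow_logb hp0 hp1.ne' hxp]
  refine ⟨(p, -Real.logb p (x p)), ⟨hp, ?_, fun n hn => ?_⟩, ?_⟩
  · exact neg_pos.mpr (Real.logb_neg hp1 hxp hlt)
  · dsimp only
    rw [hx.eq_pow_padicValInt hb hp hlt hn, ← neg_mul, Real.rpow_mul hp0.le, hε,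
      Real.rpow_natCast]
  · rintro ⟨q, δ⟩ ⟨hq, hδ, hxq⟩
    dsimp only at hq hδ hxq
    have hq1 : (1 : ℝ) < q := by exact_mod_cast hq.one_lt
    have hxqq : x q = (q : ℝ) ^ (-δ) := by
      have := hxq q (by exact_mod_cast hq.ne_zero)
      rwa [padicValInt.self hq.one_lt, Nat.cast_one, mul_one] at this
    have hqlt : x q < 1 := hxqq ▸ Real.rpow_lt_one_of_one_lt_of_neg hq1 (neg_neg_of_pos hδ)
    obtain rfl : q = p := by
      by_contra hne
      exact hx.not_lt_one_of_isCoprime hb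
        (Nat.isCoprime_iff_coprime.mpr ((Nat.coprime_primes hq hp).mpr hne)) hqlt hlt
    rw [hxqq, Real.logb_rpow hp0 hp1.ne', neg_neg]
end

section
/- For any two distinct primes p and q, the images of the branch maps f_p and f_q intersect exactly in the trivial seminorm: f_p([0,1]) ∩ f_q([0,1]) = {x₀}, where x₀ ∈ M(ℤ) is the seminorm with x₀(n) = 1 for all n ≠ 0. Likewise, for any prime p, f_p([0,1]) ∩ f_∞([0,1]) = {x₀}. -/
/-- The trivial seminorm `x₀ ∈ M(ℤ)`. -/
def trivialSeminorm : ℤ → ℝ := fun n => if n = 0 then 0 else 1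

@[simp]
theorem fp_one (p : ℕ) : fp p 1 = trivialSeminorm := by
  funext n
  simp [fp, trivialSeminorm]

@[simp]
theorem finfty_zero : finfty 0 = trivialSeminorm := by
  funext n
  simp [finfty, trivialSeminorm]

theorem fp_apply_self {p : ℕ} (hp : p.Prime) (ε : ℝ) : fp p ε p = ε := by
  have : Fact p.Prime := ⟨hp⟩
  simp [fp, hp.ne_zero, padicValInt.self hp.one_lt]

theorem fp_apply_of_not_dvd {p n : ℕ} (h : ¬ p ∣ n) (ε : ℝ) : fp p ε n = 1 := by
  have hn : n ≠ 0 := by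
    rintro rfl
    exact h (dvd_zero p)
  simp [fp, hn, padicValNat.eq_zero_of_not_dvd h]

theorem eq_zero_of_finfty_apply_eq_one {n : ℕ} (hn : 1 < n) {δ : ℝ} (h : finfty δ n = 1) :
    δ = 0 := by
  have hn0 : n ≠ 0 := by omega
  have hn1 : (1 : ℝ) < n := by exact_mod_cast hn
  have hpow : (n : ℝ) ^ δ = 1 := by simpa [finfty, hn0] using h
  exact (Real.rpow_right_inj (by positivity) hn1.ne').1 (hpow.trans (Real.rpow_zero _).symm)

/-- Distinct branches of `M(ℤ)` meet exactly in the trivial seminorm. -/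
theorem berkZ_branches_meet_in_trivial (p q : ℕ) (hp : p.Prime) (hq : q.Prime)
    (hpq : p ≠ q) :
    fp p '' Set.Icc (0:ℝ) 1 ∩ fp q '' Set.Icc (0:ℝ) 1 = {trivialSeminorm} ∧
      fp p '' Set.Icc (0:ℝ) 1 ∩ finfty '' Set.Icc (0:ℝ) 1 = {trivialSeminorm} := by
  constructor
  · refine Set.Subset.antisymm ?_ (Set.singleton_subset_iff.2
      ⟨⟨1, by simp, fp_one p⟩, ⟨1, by simp, fp_one q⟩⟩)
    rintro _ ⟨⟨ε, -, rfl⟩, ⟨δ, -, h⟩⟩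
    have hqp : ¬ q ∣ p := fun hd => hpq ((Nat.prime_dvd_prime_iff_eq hq hp).1 hd).symm
    have hε : ε = 1 := by
      rw [← fp_apply_self hp ε, ← h, fp_apply_of_not_dvd hqp]
    simp [hε]
  · refine Set.Subset.antisymm ?_ (Set.singleton_subset_iff.2
      ⟨⟨1, by simp, fp_one p⟩, ⟨0, by simp, finfty_zero⟩⟩)
    rintro _ ⟨⟨ε, -, rfl⟩, ⟨δ, -, h⟩⟩
    have hdvd : ¬ p ∣ p + 1 := fun hd =>
      hp.one_lt.ne' (Nat.dvd_one.1 ((Nat.dvd_add_right (dvd_refl p)).1 hd))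
    have hδ : δ = 0 := eq_zero_of_finfty_apply_eq_one (Nat.lt_add_of_pos_left hp.pos)
      (by rw [h, fp_apply_of_not_dvd hdvd])
    simp [← h, hδ]
end

section
/- The series over the primes ∑_{p prime} 1/(p·log p) converges, i.e., the function p ↦ 1/(p·log p) is summable over the set of prime numbers. -/
/-- The sum of `log p` over primes `p ≤ n` is at most `n * log 4`, by Chebyshev's bound. -/
lemma sum_log_primes_le (s : Finset Nat.Primes) (n : ℕ) (hs : ∀ p ∈ s, (p : ℕ) ≤ n) :
    ∑ p ∈ s, Real.log (p : ℕ) ≤ Real.log 4 * n := by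
  refine le_trans ?_ (Chebyshev.theta_le_log4_mul_x (Nat.cast_nonneg n))
  rw [Chebyshev.theta_eq_sum_primesLE_log]
  refine (Finset.sum_map s ⟨fun p : Nat.Primes ↦ (p : ℕ), Nat.Primes.coe_nat_injective⟩
    fun p : ℕ ↦ Real.log p).symm.trans_le ?_
  refine Finset.sum_le_sum_of_subset_of_nonneg (fun q hq ↦ ?_)
    fun q _ _ ↦ Real.log_natCast_nonneg q
  obtain ⟨p, hp, rfl⟩ := Finset.mem_map.1 hq
  exact Nat.mem_primesLE.2 ⟨hs p hp, p.2⟩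

lemma one_div_prime_mul_log_le (p : Nat.Primes) :
    1 / ((p : ℝ) * Real.log (p : ℕ)) ≤
      Real.log (p : ℕ) / (2 ^ Nat.log 2 p * (Nat.log 2 p * Real.log 2) ^ 2) := by
  have hk : 0 < Nat.log 2 p := Nat.log_pos one_lt_two p.2.two_le
  have hpow : (2 : ℝ) ^ Nat.log 2 p ≤ (p : ℕ) := mod_cast Nat.pow_log_le_self 2 p.2.ne_zero
  have hlog2 : 0 < Real.log 2 := Real.log_pos one_lt_two
  have hlog : Nat.log 2 p * Real.log 2 ≤ Real.log (p : ℕ) := by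
    rw [← Real.log_pow]
    exact Real.log_le_log (by positivity) hpow
  have hk' : (0 : ℝ) < Nat.log 2 p := mod_cast hk
  have hlogp : 0 < Real.log (p : ℕ) := lt_of_lt_of_le (by positivity) hlog
  have hp : (0 : ℝ) < (p : ℕ) := mod_cast p.2.pos
  calc 1 / ((p : ℝ) * Real.log (p : ℕ))
      = Real.log (p : ℕ) / ((p : ℕ) * Real.log (p : ℕ) ^ 2) := by field_simp
    _ ≤ _ := by gcongr

/-- The contribution of primes in a dyadic block to `∑ 1 / (p * log p)`. -/
lemma sum_dyadic_one_div_prime_mul_log_le (s : Finset Nat.Primes) (k : ℕ)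
    (hs : ∀ p ∈ s, Nat.log 2 p = k) :
    ∑ p ∈ s, 1 / ((p : ℝ) * Real.log (p : ℕ)) ≤
      2 * Real.log 4 / Real.log 2 ^ 2 * (1 / (k : ℝ) ^ 2) := by
  have hlog := sum_log_primes_le s (2 ^ (k + 1)) fun p hp ↦ by
    rw [← hs p hp]
    exact (Nat.lt_pow_succ_log_self one_lt_two _).le
  calc ∑ p ∈ s, 1 / ((p : ℝ) * Real.log (p : ℕ))
      ≤ ∑ p ∈ s, Real.log (p : ℕ) / (2 ^ k * (k * Real.log 2) ^ 2) :=
        Finset.sum_le_sum fun p hp ↦ by simpa only [hs p hp] using one_div_prime_mul_log_le p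
    _ = (∑ p ∈ s, Real.log (p : ℕ)) / (2 ^ k * (k * Real.log 2) ^ 2) :=
        (Finset.sum_div ..).symm
    _ ≤ Real.log 4 * (2 ^ (k + 1) : ℕ) / (2 ^ k * (k * Real.log 2) ^ 2) := by gcongr
    _ = 2 * Real.log 4 / Real.log 2 ^ 2 * (1 / (k : ℝ) ^ 2) := by
        rw [Nat.cast_pow, Nat.cast_ofNat, pow_succ, mul_pow]
        field_simp

/-- The series `∑_{p prime} 1/(p · log p)` converges. -/
theorem summable_one_div_prime_mul_log :
    Summable (fun p : Nat.Primes => 1 / ((p : ℝ) * Real.log (p : ℕ))) := by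
  have hsum : Summable fun k : ℕ ↦ 2 * Real.log 4 / Real.log 2 ^ 2 * (1 / (k : ℝ) ^ 2) :=
    (Real.summable_one_div_nat_pow.2 one_lt_two).mul_left _
  refine summable_of_sum_le (c := ∑' k : ℕ, 2 * Real.log 4 / Real.log 2 ^ 2 * (1 / (k : ℝ) ^ 2))
    (fun p ↦ ?_) fun u ↦ ?_
  · exact one_div_nonneg.2 (mul_nonneg (Nat.cast_nonneg _) (Real.log_natCast_nonneg _))
  · rw [← Finset.sum_fiberwise_of_maps_to (g := fun p : Nat.Primes ↦ Nat.log 2 p)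
      fun p hp ↦ Finset.mem_image_of_mem (fun p : Nat.Primes ↦ Nat.log 2 p) hp]
    refine (Finset.sum_le_sum fun k _ ↦ sum_dyadic_one_div_prime_mul_log_le _ k fun p hp ↦
      (Finset.mem_filter.1 hp).2).trans (hsum.sum_le_tsum _ fun k _ ↦ ?_)
    have : 0 ≤ Real.log 4 := Real.log_nonneg (by norm_num)
    positivity
end
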